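/- arXiv:1407.1118 — 2 statements merged into one kernel-verified Lean document; each statement's English description precedes it below -/
import Mathlib

section
/- Define A : ℝ → ℝ by A(c) = (1/2)∫_{-1}^{1} e^{cx} dx and F : ℝ → ℝ by F(c) = A(c)^{-1}·∫_{-1}^{1} (cx − log A(c)) e^{cx} dx. Then F is differentiable and for every c ∈ ℝ, F'(c) = (c/(2 A(c)²))·[(∫_{-1}^{1} x² e^{cx} dx)(∫_{-1}^{1} e^{cx} dx) − (∫_{-1}^{1} x e^{cx} dx)²]. -/
/-- Differentiation under the integral sign for the exponential family `c ↦ ∫ f(x) e^{cx} dx`. -/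
theorem hasDerivAt_intervalIntegral_mul_exp {f : ℝ → ℝ} (hf : Continuous f) (a b c : ℝ) :
    HasDerivAt (fun c : ℝ => ∫ x in a..b, f x * Real.exp (c * x))
      (∫ x in a..b, x * f x * Real.exp (c * x)) c := by
  refine (intervalIntegral.hasDerivAt_integral_of_dominated_loc_of_deriv_le
    (F := fun c x => f x * Real.exp (c * x))
    (F' := fun c x => x * f x * Real.exp (c * x))
    (bound := fun x => |x * f x| * Real.exp ((|c| + 1) * |x|))
    (Metric.ball_mem_nhds c one_pos) ?_ ?_ ?_ ?_ ?_ ?_).2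
  · exact .of_forall fun y => (by fun_prop : Continuous _).aestronglyMeasurable
  · exact (by fun_prop : Continuous _).intervalIntegrable _ _
  · exact (by fun_prop : Continuous _).aestronglyMeasurable
  · refine .of_forall fun x _ y hy => ?_
    have hy' : |y| ≤ |c| + 1 := by
      have h₁ : |y - c| < 1 := by simpa [Real.dist_eq] using hy
      have h₂ := abs_sub_abs_le_abs_sub y c
      linarith
    have hyx : y * x ≤ (|c| + 1) * |x| :=
      calc y * x ≤ |y * x| := le_abs_self _
        _ = |y| * |x| := abs_mul _ _
        _ ≤ (|c| + 1) * |x| := by gcongr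
    rw [norm_mul, Real.norm_eq_abs, Real.norm_eq_abs, Real.abs_exp]
    exact mul_le_mul_of_nonneg_left (Real.exp_le_exp.mpr hyx) (abs_nonneg _)
  · exact (by fun_prop : Continuous _).intervalIntegrable _ _
  · refine .of_forall fun x _ y _ => ?_
    refine ((((hasDerivAt_id y).mul_const x).exp).const_mul (f x)).congr_deriv ?_
    simp only [id]
    ring

/-- Let `A c = (1/2) ∫_{-1}^{1} e^{cx} dx` and
`F c = A(c)⁻¹ ∫_{-1}^{1} (cx − log A(c)) e^{cx} dx`. Then `F` is differentiable with
`F'(c) = (c / (2 A(c)²)) [(∫ x² e^{cx})(∫ e^{cx}) − (∫ x e^{cx})²]` for every `c`. -/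
theorem soliton_entropy_hasDerivAt
    (A F : ℝ → ℝ)
    (hA : ∀ c : ℝ, A c = (1 / 2) * ∫ x in (-1 : ℝ)..1, Real.exp (c * x))
    (hF : ∀ c : ℝ, F c = (A c)⁻¹
        * ∫ x in (-1 : ℝ)..1, (c * x - Real.log (A c)) * Real.exp (c * x)) :
    ∀ c : ℝ,
      HasDerivAt F
        ((c / (2 * A c ^ 2))
          * ((∫ x in (-1 : ℝ)..1, x ^ 2 * Real.exp (c * x))
              * (∫ x in (-1 : ℝ)..1, Real.exp (c * x))
            - (∫ x in (-1 : ℝ)..1, x * Real.exp (c * x)) ^ 2)) c := by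
  intro c
  have hM₀ : HasDerivAt (fun c : ℝ => ∫ x in (-1 : ℝ)..1, Real.exp (c * x))
      (∫ x in (-1 : ℝ)..1, x * Real.exp (c * x)) c := by
    simpa using hasDerivAt_intervalIntegral_mul_exp (continuous_const (y := (1 : ℝ))) (-1) 1 c
  have hM₁ : HasDerivAt (fun c : ℝ => ∫ x in (-1 : ℝ)..1, x * Real.exp (c * x))
      (∫ x in (-1 : ℝ)..1, x ^ 2 * Real.exp (c * x)) c := by
    simpa [sq] using hasDerivAt_intervalIntegral_mul_exp continuous_id (-1) 1 c
  have hM : ∀ c, ∫ x in (-1 : ℝ)..1, Real.exp (c * x) = 2 * A c := fun c => by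
    rw [hA]
    ring
  have hApos : ∀ c, 0 < A c := fun c => by
    rw [hA]
    have : 0 < ∫ x in (-1 : ℝ)..1, Real.exp (c * x) :=
      intervalIntegral.intervalIntegral_pos_of_pos
        ((by fun_prop : Continuous _).intervalIntegrable _ _)
        (fun x => Real.exp_pos _) (by norm_num)
    positivity
  have hA' : HasDerivAt A (1 / 2 * ∫ x in (-1 : ℝ)..1, x * Real.exp (c * x)) c := by
    rw [funext hA]
    exact hM₀.const_mul _
  have hF' : F = fun c =>
      c * (∫ x in (-1 : ℝ)..1, x * Real.exp (c * x)) / A c - 2 * Real.log (A c) := by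
    funext c
    have hsplit : ∫ x in (-1 : ℝ)..1, (c * x - Real.log (A c)) * Real.exp (c * x)
        = c * (∫ x in (-1 : ℝ)..1, x * Real.exp (c * x))
          - Real.log (A c) * ∫ x in (-1 : ℝ)..1, Real.exp (c * x) := by
      rw [← intervalIntegral.integral_const_mul, ← intervalIntegral.integral_const_mul,
        ← intervalIntegral.integral_sub ((by fun_prop : Continuous _).intervalIntegrable _ _)
          ((by fun_prop : Continuous _).intervalIntegrable _ _)]
      congr 1
      funext x
      ring
    have hne := (hApos c).ne'
    rw [hF, hsplit, hM]
    field_simp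
  have hne := (hApos c).ne'
  rw [hF', hM]
  have h := (((hasDerivAt_id c).mul hM₁).div hA' hne).sub ((hA'.log hne).const_mul 2)
  refine h.congr_deriv ?_
  simp only [id, Pi.mul_apply]
  generalize (∫ x in (-1 : ℝ)..1, x * Real.exp (c * x)) = M₁
  generalize (∫ x in (-1 : ℝ)..1, x ^ 2 * Real.exp (c * x)) = M₂
  field_simp
  ring
end

section
/- Define A : ℝ → ℝ by A(c) = (1/2)∫_{-1}^{1} e^{cx} dx and F : ℝ → ℝ by F(c) = A(c)^{-1}·∫_{-1}^{1} (cx − log A(c)) e^{cx} dx. Then F(−c) = F(c) for all c ∈ ℝ, F'(c) > 0 for c > 0 and F'(c) < 0 for c < 0; consequently F(c₁) < F(c₂) whenever 0 ≤ c₁ < c₂. In particular F is strictly increasing as a function of |c|. -/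
theorem integral_exp_mul_symm {c : ℝ} (hc : c ≠ 0) :
    ∫ x in (-1 : ℝ)..1, Real.exp (c * x) = 2 * (Real.sinh c / c) := by
  have h : ∀ x ∈ Set.uIcc (-1 : ℝ) 1,
      HasDerivAt (fun x : ℝ => Real.exp (c * x) / c) (Real.exp (c * x)) x := fun x _ => by
    have := (((hasDerivAt_id x).const_mul c).exp).div_const c
    simpa [hc] using this
  rw [intervalIntegral.integral_eq_sub_of_hasDerivAt h
    (Continuous.intervalIntegrable (by fun_prop) _ _), Real.sinh_eq]
  simp only [mul_one, mul_neg]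
  ring

theorem integral_linear_sub_const_mul_exp {c : ℝ} (hc : c ≠ 0) (a : ℝ) :
    ∫ x in (-1 : ℝ)..1, (c * x - a) * Real.exp (c * x) =
      2 * (Real.cosh c - (1 + a) * (Real.sinh c / c)) := by
  have h : ∀ x ∈ Set.uIcc (-1 : ℝ) 1,
      HasDerivAt (fun x : ℝ => (x - (1 + a) / c) * Real.exp (c * x))
        ((c * x - a) * Real.exp (c * x)) x := fun x _ => by
    have := ((hasDerivAt_id x).sub_const ((1 + a) / c)).mul ((hasDerivAt_id x).const_mul c).exp
    refine this.congr_deriv ?_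
    simp only [id]
    field_simp
    ring
  rw [intervalIntegral.integral_eq_sub_of_hasDerivAt h
    (Continuous.intervalIntegrable (by fun_prop) _ _), Real.sinh_eq, Real.cosh_eq]
  simp only [mul_one, mul_neg]
  ring

theorem sinh_div_self_pos {c : ℝ} (hc : c ≠ 0) : 0 < Real.sinh c / c := by
  rcases hc.lt_or_gt with h | h
  · exact div_pos_of_neg_of_neg (Real.sinh_neg_iff.2 h) h
  · exact div_pos (Real.sinh_pos_iff.2 h) h

theorem sq_lt_sinh_sq {c : ℝ} (hc : c ≠ 0) : c ^ 2 < Real.sinh c ^ 2 := by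
  rcases hc.lt_or_gt with h | h
  · nlinarith [Real.sinh_lt_self_iff.2 h]
  · nlinarith [Real.self_lt_sinh_iff.2 h]

theorem hasDerivAt_mul_coth_sub_log_sinh_div {c : ℝ} (hc : c ≠ 0) :
    HasDerivAt
      (fun c : ℝ => 2 * (c * Real.cosh c / Real.sinh c - 1 - Real.log (Real.sinh c / c)))
      (2 * (1 / c - c / Real.sinh c ^ 2)) c := by
  have hs : Real.sinh c ≠ 0 := Real.sinh_ne_zero.2 hc
  have hcoth := ((hasDerivAt_id c).mul (Real.hasDerivAt_cosh c)).div (Real.hasDerivAt_sinh c) hs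
  have hlog := ((Real.hasDerivAt_sinh c).div (hasDerivAt_id c) hc).log (sinh_div_self_pos hc).ne'
  refine (((hcoth.sub_const 1).sub hlog).const_mul 2).congr_deriv ?_
  simp only [id, Pi.mul_apply, Pi.div_apply]
  field_simp
  linear_combination (-c ^ 2) * Real.cosh_sq c

/-- Let `A c = (1/2) ∫_{-1}^{1} e^{cx} dx` and
`F c = A(c)⁻¹ ∫_{-1}^{1} (cx − log A(c)) e^{cx} dx`. Then `F(-c) = F(c)` for all `c`,
`F' > 0` on `(0, ∞)` and `F' < 0` on `(-∞, 0)`; consequently `F c₁ < F c₂` whenever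
`0 ≤ c₁ < c₂`. In particular `F` is strictly increasing as a function of `|c|`. -/
theorem soliton_entropy_strictMono_in_abs
    (A F : ℝ → ℝ)
    (hA : ∀ c : ℝ, A c = (1 / 2) * ∫ x in (-1 : ℝ)..1, Real.exp (c * x))
    (hF : ∀ c : ℝ, F c = (A c)⁻¹
        * ∫ x in (-1 : ℝ)..1, (c * x - Real.log (A c)) * Real.exp (c * x)) :
    (∀ c : ℝ, F (-c) = F c) ∧
    (∀ c : ℝ, 0 < c → 0 < deriv F c) ∧
    (∀ c : ℝ, c < 0 → deriv F c < 0) ∧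
    (∀ c₁ c₂ : ℝ, 0 ≤ c₁ → c₁ < c₂ → F c₁ < F c₂) ∧
    (∀ c₁ c₂ : ℝ, |c₁| < |c₂| → F c₁ < F c₂) := by
  have hA_ne : ∀ c, c ≠ 0 → A c = Real.sinh c / c := fun c hc => by
    rw [hA, integral_exp_mul_symm hc]
    ring
  have hA_zero : A 0 = 1 := by norm_num [hA]
  have hA_pos : ∀ c, 0 < A c := fun c => by
    rcases eq_or_ne c 0 with rfl | hc
    · simp [hA_zero]
    · exact hA_ne c hc ▸ sinh_div_self_pos hc
  have hF_ne : ∀ c, c ≠ 0 →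
      F c = 2 * (c * Real.cosh c / Real.sinh c - 1 - Real.log (Real.sinh c / c)) := fun c hc => by
    have hs : Real.sinh c ≠ 0 := Real.sinh_ne_zero.2 hc
    rw [hF, integral_linear_sub_const_mul_exp hc, hA_ne c hc]
    field_simp
    ring
  have hF_deriv : ∀ c, c ≠ 0 → deriv F c = 2 * (1 / c - c / Real.sinh c ^ 2) := fun c hc =>
    ((hasDerivAt_mul_coth_sub_log_sinh_div hc).congr_of_eventuallyEq
      ((eventually_ne_nhds hc).mono hF_ne)).deriv
  have hA_cont : Continuous A := by
    rw [funext hA]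
    exact continuous_const.mul
      (intervalIntegral.continuous_parametric_intervalIntegral_of_continuous' (by fun_prop) _ _)
  have hlog_cont : Continuous fun c => Real.log (A c) := hA_cont.log fun c => (hA_pos c).ne'
  have hF_cont : Continuous F := by
    rw [funext hF]
    refine (hA_cont.inv₀ fun c => (hA_pos c).ne').mul
      (intervalIntegral.continuous_parametric_intervalIntegral_of_continuous' ?_ _ _)
    have := hlog_cont.comp (continuous_fst (X := ℝ) (Y := ℝ))
    simp only [Function.comp_def] at this
    simp only [Function.uncurry_def]
    fun_prop
  have heven : ∀ c, F (-c) = F c := fun c => by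
    rcases eq_or_ne c 0 with rfl | hc
    · simp
    · rw [hF_ne c hc, hF_ne (-c) (neg_ne_zero.2 hc), Real.cosh_neg, Real.sinh_neg,
        neg_div_neg_eq, neg_mul, neg_div_neg_eq]
  have hderiv_pos : ∀ c, 0 < c → 0 < deriv F c := fun c hc => by
    have hs := Real.sinh_pos_iff.2 hc
    rw [hF_deriv c hc.ne']
    refine mul_pos two_pos (sub_pos.2 ?_)
    rw [div_lt_div_iff₀ (by positivity) hc]
    linarith [sq_lt_sinh_sq hc.ne']
  have hderiv_neg : ∀ c, c < 0 → deriv F c < 0 := fun c hc => by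
    have h := hderiv_pos (-c) (neg_pos.2 hc)
    rw [hF_deriv _ (neg_ne_zero.2 hc.ne)] at h
    rw [hF_deriv c hc.ne]
    simp only [Real.sinh_neg, div_neg, neg_div, neg_sq] at h
    linarith
  have hmono : StrictMonoOn F (Set.Ici 0) :=
    strictMonoOn_of_deriv_pos (convex_Ici 0) hF_cont.continuousOn fun c hc =>
      hderiv_pos c (by simpa using hc)
  have habs : ∀ c, F |c| = F c := fun c => by
    rcases abs_choice c with h | h <;> simp [h, heven]
  refine ⟨heven, hderiv_pos, hderiv_neg, fun c₁ c₂ h₁ h => hmono h₁ (h₁.trans h.le) h,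
    fun c₁ c₂ h => ?_⟩
  rw [← habs c₁, ← habs c₂]
  exact hmono (abs_nonneg c₁) (abs_nonneg c₂) h
end
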